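/- arXiv:2412.02118 — 2 statements merged into one kernel-verified Lean document; each statement's English description precedes it below -/
import Mathlib

section
/- For any positive integer k and any ideal I of the Indigenous semiring S_k with {0} ≠ I ≠ S_k, the radical of I equals S_k \ {1} = {x ∈ S_k : x ≠ 1}; consequently the only radical ideals of S_k are {0}, S_k \ {1}, and S_k. -/
/-- The ring congruence on ℕ identifying all numbers greater than `k`. -/
def indCon (k : ℕ) : RingCon ℕ where
  r a b := a = b ∨ (k < a ∧ k < b)
  iseqv := by
    refine ⟨fun _ => Or.inl rfl, ?_, ?_⟩
    · rintro a b (rfl | ⟨h1, h2⟩)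
      · exact Or.inl rfl
      · exact Or.inr ⟨h2, h1⟩
    · rintro a b c (rfl | ⟨h1, h2⟩) (rfl | ⟨h3, h4⟩)
      · exact Or.inl rfl
      · exact Or.inr ⟨h3, h4⟩
      · exact Or.inr ⟨h1, h2⟩
      · exact Or.inr ⟨h1, h4⟩
  add' := by
    rintro a b c d (rfl | ⟨ha, hb⟩) (rfl | ⟨hc, hd⟩)
    · exact Or.inl rfl
    · exact Or.inr ⟨by omega, by omega⟩
    · exact Or.inr ⟨by omega, by omega⟩
    · exact Or.inr ⟨by omega, by omega⟩
  mul' := by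
    rintro a b c d (rfl | ⟨ha, hb⟩) (rfl | ⟨hc, hd⟩)
    · exact Or.inl rfl
    · rcases Nat.eq_zero_or_pos a with rfl | ha0
      · simp
      · exact Or.inr ⟨lt_of_lt_of_le hc (Nat.le_mul_of_pos_left c ha0),
          lt_of_lt_of_le hd (Nat.le_mul_of_pos_left d ha0)⟩
    · rcases Nat.eq_zero_or_pos c with rfl | hc0
      · simp
      · exact Or.inr ⟨lt_of_lt_of_le ha (Nat.le_mul_of_pos_right a hc0),
          lt_of_lt_of_le hb (Nat.le_mul_of_pos_right b hc0)⟩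
    · exact Or.inr ⟨lt_of_lt_of_le ha (Nat.le_mul_of_pos_right a (by omega)),
        lt_of_lt_of_le hb (Nat.le_mul_of_pos_right b (by omega))⟩

/-- The Indigenous semiring `S_k = {0, 1, ..., k} ∪ {m}`, realized as the quotient of ℕ
by the congruence identifying all numbers greater than `k`. -/
abbrev IndSemiring (k : ℕ) : Type := (indCon k).Quotient

/-- The element `m` ("many") of the Indigenous semiring. -/
def indM (k : ℕ) : IndSemiring k := (indCon k).mk' (k + 1)


theorem indCon_mk_eq_indM {k a : ℕ} (h : k < a) :
    ((indCon k).mk' a : IndSemiring k) = indM k :=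
  (indCon k).eq.2 (Or.inr ⟨h, k.lt_succ_self⟩)

theorem indM_mem_of_ne_bot {k : ℕ} {I : Ideal (IndSemiring k)} (hI : I ≠ ⊥) : indM k ∈ I := by
  obtain ⟨x, hx, hx0⟩ := Submodule.exists_mem_ne_zero_of_ne_bot hI
  obtain ⟨a, rfl⟩ := (indCon k).mk'_surjective x
  have ha : 0 < a := Nat.pos_of_ne_zero fun h => hx0 (by rw [h, map_zero])
  have hmul := I.mul_mem_left (indM k) hx
  rwa [indM, ← map_mul, indCon_mk_eq_indM (Nat.le_mul_of_pos_right (k + 1) ha)] at hmul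

theorem IndSemiring.pow_eq_indM {k : ℕ} {x : IndSemiring k} (h0 : x ≠ 0) (h1 : x ≠ 1) :
    x ^ k.succ = indM k := by
  obtain ⟨a, rfl⟩ := (indCon k).mk'_surjective x
  have ha0 : a ≠ 0 := fun h => h0 (by rw [h, map_zero])
  have ha1 : a ≠ 1 := fun h => h1 (by rw [h, map_one])
  have ha : 1 < a := by omega
  rw [← map_pow]
  exact indCon_mk_eq_indM (k.lt_succ_self.trans (Nat.lt_pow_self ha))

theorem IndSemiring.mem_radical_iff {k : ℕ} {I : Ideal (IndSemiring k)} (hbot : I ≠ ⊥)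
    (htop : I ≠ ⊤) (x : IndSemiring k) : x ∈ I.radical ↔ x ≠ 1 := by
  constructor
  · rintro ⟨n, hn⟩ rfl
    exact htop ((Ideal.eq_top_iff_one I).2 (by simpa using hn))
  · intro h1
    by_cases h0 : x = 0
    · exact h0 ▸ I.radical.zero_mem
    · exact ⟨k.succ, IndSemiring.pow_eq_indM h0 h1 ▸ indM_mem_of_ne_bot hbot⟩

/-- For any positive integer `k` and any nonzero proper ideal `I` of `S_k`, the radical of
`I` equals `S_k \ {1}`; consequently the only radical ideals of `S_k` are `{0}`,
`S_k \ {1}`, and `S_k`. -/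
theorem radical_ideals_indSemiring (k : ℕ) (hk : 0 < k) :
    (∀ I : Ideal (IndSemiring k), I ≠ ⊥ → I ≠ ⊤ →
      ∀ x : IndSemiring k, x ∈ I.radical ↔ x ≠ 1) ∧
    (∀ I : Ideal (IndSemiring k), I.radical = I →
      I = ⊥ ∨ (∀ x : IndSemiring k, x ∈ I ↔ x ≠ 1) ∨ I = ⊤) := by
  refine ⟨fun I hbot htop => IndSemiring.mem_radical_iff hbot htop, fun I hI => ?_⟩
  by_cases hbot : I = ⊥
  · exact Or.inl hbot
  by_cases htop : I = ⊤
  · exact Or.inr (Or.inr htop)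
  · exact Or.inr (Or.inl fun x => hI ▸ IndSemiring.mem_radical_iff hbot htop x)
end

section
/- Let k be a positive integer, let α and β be elements of the Indigenous semiring S_k with α ≠ 0, and consider the polynomial f = αX² + β in S_k[X]. Then f is irreducible in S_k[X] if and only if one of the following holds: (1) α and β are both (images of) positive integers a, b with 1 ≤ a, b ≤ k and gcd(a, b) = 1; (2) α = m and β = 1; (3) α = 1 and β = m. -/
open Polynomial in
/-- Over a zero-sum-free semiring without zero divisors, `αX² + β` is irreducible if and only if
`β ≠ 0` and the coefficients have no common non-unit factor. -/
theorem irreducible_C_mul_X_sq_add_C_iff {R : Type*} [CommSemiring R] [Nontrivial R]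
    [NoZeroDivisors R] (hadd : ∀ a b : R, a + b = 0 → a = 0) {α β : R} (hα : α ≠ 0) :
    Irreducible (C α * X ^ 2 + C β) ↔ β ≠ 0 ∧ IsRelPrime α β := by
  have not_unit {γ : R} : ¬ IsUnit (C α * X ^ 2 + C γ) := by
    intro h
    obtain ⟨r, -, hr⟩ := isUnit_iff.mp h
    have := congrArg (coeff · 2) hr
    simp at this
    exact hα this.symm
  constructor
  · intro h
    constructor
    · rintro rfl
      have hX : ∀ γ : R, ¬ IsUnit (C γ * X) := by
        intro γ hu
        obtain ⟨r, hr, hr'⟩ := isUnit_iff.mp hu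
        have := congrArg (coeff · 0) hr'
        simp at this
        exact hr.ne_zero this
      rcases h.isUnit_or_isUnit (a := C α * X) (b := C 1 * X) (by simp; ring) with hu | hu
      · exact hX _ hu
      · exact hX _ hu
    · rintro d ⟨u, rfl⟩ ⟨v, rfl⟩
      rcases h.isUnit_or_isUnit (a := C d) (b := C u * X ^ 2 + C v)
        (by simp only [C_mul]; ring) with hu | hu
      · exact isUnit_C.mp hu
      · refine absurd ?_ (not_unit (γ := d * v))
        obtain ⟨r, -, hr⟩ := isUnit_iff.mp hu
        have := congrArg (coeff · 2) hr
        simp at this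
        exact absurd (by simp [← this]) hα
  · rintro ⟨hβ, hrel⟩
    refine ⟨not_unit, fun g h hgh => ?_⟩
    have const_unit : ∀ p q : R[X], C α * X ^ 2 + C β = p * q → p.natDegree = 0 → IsUnit p := by
      intro p q hpq hp
      rw [eq_C_of_natDegree_eq_zero hp] at hpq ⊢
      refine isUnit_C.mpr (hrel ⟨q.coeff 2, ?_⟩ ⟨q.coeff 0, ?_⟩)
      · simpa [coeff_C] using congrArg (coeff · 2) hpq
      · simpa using congrArg (coeff · 0) hpq
    have hne : g * h ≠ 0 := by
      rw [← hgh]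
      intro h0
      have := congrArg (coeff · 2) h0
      simp at this
      exact hα this
    have hdeg : g.natDegree + h.natDegree = 2 := by
      rw [← natDegree_mul (left_ne_zero_of_mul hne) (right_ne_zero_of_mul hne), ← hgh,
        natDegree_add_C, natDegree_C_mul_X_pow _ _ hα]
    by_cases hg : g.natDegree = 0
    · exact Or.inl (const_unit g h hgh hg)
    by_cases hh : h.natDegree = 0
    · exact Or.inr (const_unit h g (by rw [hgh, mul_comm]) hh)
    exfalso
    have hh1 : h.coeff 1 ≠ 0 := by
      have : h.natDegree = 1 := by omega
      rw [← this]
      exact leadingCoeff_ne_zero.mpr (right_ne_zero_of_mul hne)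
    have h1 := congrArg (coeff · 1) hgh
    have h0 := congrArg (coeff · 0) hgh
    simp [coeff_C, mul_coeff_one] at h1 h0
    rcases mul_eq_zero.mp (hadd _ _ h1.symm) with h' | h'
    · exact hβ (by rw [h0, h', zero_mul])
    · exact hh1 h'

theorem indCon_mk'_eq_iff {k a b : ℕ} :
    (indCon k).mk' a = (indCon k).mk' b ↔ a = b ∨ (k < a ∧ k < b) :=
  (indCon k).eq

theorem indCon_mk'_eq_iff_of_le {k a b : ℕ} (hb : b ≤ k) :
    (indCon k).mk' a = (indCon k).mk' b ↔ a = b := by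
  rw [indCon_mk'_eq_iff]
  omega

theorem indCon_mk'_eq_zero_iff {k a : ℕ} : (indCon k).mk' a = 0 ↔ a = 0 := by
  rw [← map_zero (indCon k).mk', indCon_mk'_eq_iff_of_le (Nat.zero_le k)]

theorem indCon_mk'_eq_indM_iff {k a : ℕ} : (indCon k).mk' a = indM k ↔ k < a := by
  rw [indM, indCon_mk'_eq_iff]
  omega

instance (k : ℕ) : Nontrivial (IndSemiring k) :=
  ⟨(indCon k).mk' 1, 0, by simp only [ne_eq, indCon_mk'_eq_zero_iff]; decide⟩

instance (k : ℕ) : NoZeroDivisors (IndSemiring k) where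
  eq_zero_or_eq_zero_of_mul_eq_zero {x y} h := by
    obtain ⟨a, rfl⟩ := (indCon k).mk'_surjective x
    obtain ⟨b, rfl⟩ := (indCon k).mk'_surjective y
    rw [← map_mul] at h
    simpa only [indCon_mk'_eq_zero_iff, mul_eq_zero] using h

theorem IndSemiring.eq_zero_of_add_eq_zero {k : ℕ} (x y : IndSemiring k) (h : x + y = 0) :
    x = 0 := by
  obtain ⟨a, rfl⟩ := (indCon k).mk'_surjective x
  obtain ⟨b, rfl⟩ := (indCon k).mk'_surjective y
  rw [← map_add, indCon_mk'_eq_zero_iff] at h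
  rw [indCon_mk'_eq_zero_iff]
  omega

theorem IndSemiring.isUnit_iff {k : ℕ} (hk : 0 < k) {x : IndSemiring k} : IsUnit x ↔ x = 1 := by
  refine ⟨fun h => ?_, fun h => h ▸ isUnit_one⟩
  obtain ⟨y, hy⟩ := h.exists_right_inv
  obtain ⟨a, rfl⟩ := (indCon k).mk'_surjective x
  obtain ⟨b, rfl⟩ := (indCon k).mk'_surjective y
  rw [← map_mul, ← map_one (indCon k).mk', indCon_mk'_eq_iff_of_le (Nat.one_le_of_lt hk)] at hy
  rw [Nat.eq_one_of_mul_eq_one_right hy, map_one]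

theorem IndSemiring.dvd_indM {k : ℕ} {x : IndSemiring k} (hx : x ≠ 0) : x ∣ indM k := by
  obtain ⟨a, rfl⟩ := (indCon k).mk'_surjective x
  refine ⟨(indCon k).mk' (k + 1), ?_⟩
  rw [ne_eq, indCon_mk'_eq_zero_iff] at hx
  rw [← map_mul, eq_comm, indCon_mk'_eq_indM_iff]
  exact Nat.le_mul_of_pos_left (k + 1) (Nat.pos_of_ne_zero hx)

theorem IndSemiring.isRelPrime_mk'_iff {k a b : ℕ} (hk : 0 < k) (ha : a ≤ k) (hb : b ≤ k) :
    IsRelPrime ((indCon k).mk' a) ((indCon k).mk' b) ↔ Nat.gcd a b = 1 := by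
  constructor
  · intro h
    have := (isUnit_iff hk).mp
      (h (map_dvd _ (Nat.gcd_dvd_left a b)) (map_dvd _ (Nat.gcd_dvd_right a b)))
    rwa [← map_one (indCon k).mk', indCon_mk'_eq_iff_of_le (Nat.one_le_of_lt hk)] at this
  · rintro h x ⟨y, hy⟩ ⟨z, hz⟩
    obtain ⟨c, rfl⟩ := (indCon k).mk'_surjective x
    obtain ⟨u, rfl⟩ := (indCon k).mk'_surjective y
    obtain ⟨v, rfl⟩ := (indCon k).mk'_surjective z
    rw [← map_mul, eq_comm, indCon_mk'_eq_iff_of_le ha] at hy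
    rw [← map_mul, eq_comm, indCon_mk'_eq_iff_of_le hb] at hz
    rw [Nat.eq_one_of_dvd_coprimes h ⟨u, hy.symm⟩ ⟨v, hz.symm⟩, map_one]
    exact isUnit_one

/-- For `α ≠ 0` and `β` in the Indigenous semiring `S_k`, the polynomial `αX² + β` is
irreducible in `S_k[X]` iff: `α` and `β` are images of positive integers `a, b ≤ k` with
`gcd(a, b) = 1`, or `α = m ∧ β = 1`, or `α = 1 ∧ β = m`. -/
theorem irreducible_quadratic_indSemiring (k : ℕ) (hk : 0 < k)
    (α β : IndSemiring k) (hα : α ≠ 0) :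
    Irreducible (Polynomial.C α * Polynomial.X ^ 2 + Polynomial.C β) ↔
      ((∃ a b : ℕ, 1 ≤ a ∧ a ≤ k ∧ 1 ≤ b ∧ b ≤ k ∧
          (indCon k).mk' a = α ∧ (indCon k).mk' b = β ∧ Nat.gcd a b = 1) ∨
        (α = indM k ∧ β = 1) ∨
        (α = 1 ∧ β = indM k)) := by
  rw [irreducible_C_mul_X_sq_add_C_iff IndSemiring.eq_zero_of_add_eq_zero hα]
  constructor
  · rintro ⟨hβ, hrel⟩
    by_cases hαm : α = indM k
    · exact Or.inr (Or.inl ⟨hαm, (IndSemiring.isUnit_iff hk).mp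
        (hrel (hαm ▸ IndSemiring.dvd_indM hβ) dvd_rfl)⟩)
    by_cases hβm : β = indM k
    · exact Or.inr (Or.inr ⟨(IndSemiring.isUnit_iff hk).mp
        (hrel dvd_rfl (hβm ▸ IndSemiring.dvd_indM hα)), hβm⟩)
    obtain ⟨a, rfl⟩ := (indCon k).mk'_surjective α
    obtain ⟨b, rfl⟩ := (indCon k).mk'_surjective β
    rw [indCon_mk'_eq_indM_iff, not_lt] at hαm hβm
    rw [ne_eq, indCon_mk'_eq_zero_iff] at hα hβ
    exact Or.inl ⟨a, b, Nat.pos_of_ne_zero hα, hαm, Nat.pos_of_ne_zero hβ, hβm, rfl, rfl,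
      (IndSemiring.isRelPrime_mk'_iff hk hαm hβm).mp hrel⟩
  · rintro (⟨a, b, -, ha, hb0, hb, rfl, rfl, hab⟩ | ⟨rfl, rfl⟩ | ⟨rfl, rfl⟩)
    · refine ⟨?_, (IndSemiring.isRelPrime_mk'_iff hk ha hb).mpr hab⟩
      rw [ne_eq, indCon_mk'_eq_zero_iff]
      omega
    · exact ⟨one_ne_zero, isRelPrime_one_right⟩
    · refine ⟨?_, isRelPrime_one_left⟩
      rw [indM, ne_eq, indCon_mk'_eq_zero_iff]
      omega
end
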